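/- arXiv:1407.5972 — 2 statements merged into one kernel-verified Lean document; each statement's English description precedes it below -/
import Mathlib

section
/- Let a = sin : ℝ → ℝ. Then for every t ∈ (0, π): (1/(665280·a(t)⁶))·(3·a^(10)(t)·a(t)⁸ − 222·a^(5)(t)²·a(t)⁷ − 348·a^(4)(t)·a^(6)(t)·a(t)⁷ − 147·a^(3)(t)·a^(7)(t)·a(t)⁷ − 18·a''(t)·a^(8)(t)·a(t)⁷ + 18·a'(t)·a^(9)(t)·a(t)⁷ − 482·a''(t)·a^(4)(t)²·a(t)⁶ − 331·a^(3)(t)²·a^(4)(t)·a(t)⁶ − 1110·a''(t)·a^(3)(t)·a^(5)(t)·a(t)⁶ − 1556·a'(t)·a^(4)(t)·a^(5)(t)·a(t)⁶ − 448·a''(t)²·a^(6)(t)·a(t)⁶ − 1074·a'(t)·a^(3)(t)·a^(6)(t)·a(t)⁶ − 476·a'(t)·a''(t)·a^(7)(t)·a(t)⁶ − 43·a'(t)²·a^(8)(t)·a(t)⁶ − 11·a^(8)(t)·a(t)⁶ + 8943·a'(t)·a^(3)(t)³·a(t)⁵ + 21846·a''(t)²·a^(3)(t)²·a(t)⁵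 + 4092·a'(t)²·a^(4)(t)²·a(t)⁵ + 396·a^(4)(t)²·a(t)⁵ + 10560·a''(t)³·a^(4)(t)·a(t)⁵ + 39402·a'(t)·a''(t)·a^(3)(t)·a^(4)(t)·a(t)⁵ + 11352·a'(t)·a''(t)²·a^(5)(t)·a(t)⁵ + 6336·a'(t)²·a^(3)(t)·a^(5)(t)·a(t)⁵ + 594·a^(3)(t)·a^(5)(t)·a(t)⁵ + 2904·a'(t)²·a''(t)·a^(6)(t)·a(t)⁵ + 264·a''(t)·a^(6)(t)·a(t)⁵ + 165·a'(t)³·a^(7)(t)·a(t)⁵ + 33·a'(t)·a^(7)(t)·a(t)⁵ − 10338·a''(t)⁵·a(t)⁴ − 95919·a'(t)²·a''(t)·a^(3)(t)²·a(t)⁴ − 3729·a''(t)·a^(3)(t)²·a(t)⁴ − 117600·a'(t)·a''(t)³·a^(3)(t)·a(t)⁴ − 68664·a'(t)²·a''(t)²·a^(4)(t)·a(t)⁴ − 2772·a''(t)²·a^(4)(t)·a(t)⁴ − 23976·a'(t)³·a^(3)(t)·a^(4)(t)·a(t)⁴ − 2640·a'(t)·a^(3)(t)·a^(4)(t)·a(t)⁴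 − 12762·a'(t)³·a''(t)·a^(5)(t)·a(t)⁴ − 1386·a'(t)·a''(t)·a^(5)(t)·a(t)⁴ − 651·a'(t)⁴·a^(6)(t)·a(t)⁴ − 132·a'(t)²·a^(6)(t)·a(t)⁴ + 111378·a'(t)²·a''(t)⁴·a(t)³ + 2354·a''(t)⁴·a(t)³ + 31344·a'(t)⁴·a^(3)(t)²·a(t)³ + 3729·a'(t)²·a^(3)(t)²·a(t)³ + 236706·a'(t)³·a''(t)²·a^(3)(t)·a(t)³ + 13926·a'(t)·a''(t)²·a^(3)(t)·a(t)³ + 43320·a'(t)⁴·a''(t)·a^(4)(t)·a(t)³ + 5214·a'(t)²·a''(t)·a^(4)(t)·a(t)³ + 2238·a'(t)⁵·a^(5)(t)·a(t)³ + 462·a'(t)³·a^(5)(t)·a(t)³ − 162162·a'(t)⁴·a''(t)³·a(t)² − 11880·a'(t)²·a''(t)³·a(t)² − 103884·a'(t)⁵·a''(t)·a^(3)(t)·a(t)² − 13332·a'(t)³·a''(t)·a^(3)(t)·a(t)² − 6138·a'(t)⁶·a^(4)(t)·a(t)² − 1287·a'(t)⁴·a^(4)(t)·a(t)² + 76440·a'(t)⁶·a''(t)²·a(t)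 + 10428·a'(t)⁴·a''(t)²·a(t) + 11700·a'(t)⁷·a^(3)(t)·a(t) + 2475·a'(t)⁵·a^(3)(t)·a(t) − 11700·a'(t)⁸·a''(t) − 2475·a'(t)⁶·a''(t)) = (31/15840)·sin(t)³. (This is the reduction to the round case a(t) = sin t of the heat coefficient a_10(t) of the Robertson–Walker metric, consistent with the round sphere expansion of Chamseddine–Connes.) -/
open Real

/-- The `k`-th derivative of the round scale factor `a = sin`. -/
noncomputable def dsin (k : ℕ) (t : ℝ) : ℝ := iteratedDeriv k Real.sin t

theorem dsin_zero (t : ℝ) : dsin 0 t = sin t := by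
  simp [dsin]

theorem dsin_one (t : ℝ) : dsin 1 t = cos t := by
  simp [dsin]

theorem dsin_add_two (k : ℕ) (t : ℝ) : dsin (k + 2) t = -dsin k t := by
  simp [dsin, iteratedDeriv_succ', iteratedDeriv_fun_neg]

/-- Reduction of the heat coefficient of the Robertson–Walker metric to the round
case `a(t) = sin t`. -/
theorem a10_round (t : ℝ) (ht0 : 0 < t) (ht1 : t < Real.pi) :
    (1/(665280 * (dsin 0 t)^6)) * (3 * (dsin 10 t) * (dsin 0 t)^8 - 222 * (dsin 5 t)^2 * (dsin
      0 t)^7 - 348 * (dsin 4 t) * (dsin 6 t) * (dsin 0 t)^7 - 147 * (dsin 3 t) * (dsin 7 t) *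
      (dsin 0 t)^7 - 18 * (dsin 2 t) * (dsin 8 t) * (dsin 0 t)^7 + 18 * (dsin 1 t) * (dsin 9 t)
      * (dsin 0 t)^7 - 482 * (dsin 2 t) * (dsin 4 t)^2 * (dsin 0 t)^6 - 331 * (dsin 3 t)^2 *
      (dsin 4 t) * (dsin 0 t)^6 - 1110 * (dsin 2 t) * (dsin 3 t) * (dsin 5 t) * (dsin 0 t)^6 -
      1556 * (dsin 1 t) * (dsin 4 t) * (dsin 5 t) * (dsin 0 t)^6 - 448 * (dsin 2 t)^2 * (dsin 6
      t) * (dsin 0 t)^6 - 1074 * (dsin 1 t) * (dsin 3 t) * (dsin 6 t) * (dsin 0 t)^6 - 476 *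
      (dsin 1 t) * (dsin 2 t) * (dsin 7 t) * (dsin 0 t)^6 - 43 * (dsin 1 t)^2 * (dsin 8 t) *
      (dsin 0 t)^6 - 11 * (dsin 8 t) * (dsin 0 t)^6 + 8943 * (dsin 1 t) * (dsin 3 t)^3 * (dsin
      0 t)^5 + 21846 * (dsin 2 t)^2 * (dsin 3 t)^2 * (dsin 0 t)^5 + 4092 * (dsin 1 t)^2 * (dsin
      4 t)^2 * (dsin 0 t)^5 + 396 * (dsin 4 t)^2 * (dsin 0 t)^5 + 10560 * (dsin 2 t)^3 * (dsin
      4 t) * (dsin 0 t)^5 + 39402 * (dsin 1 t) * (dsin 2 t) * (dsin 3 t) * (dsin 4 t) * (dsin 0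
      t)^5 + 11352 * (dsin 1 t) * (dsin 2 t)^2 * (dsin 5 t) * (dsin 0 t)^5 + 6336 * (dsin 1
      t)^2 * (dsin 3 t) * (dsin 5 t) * (dsin 0 t)^5 + 594 * (dsin 3 t) * (dsin 5 t) * (dsin 0
      t)^5 + 2904 * (dsin 1 t)^2 * (dsin 2 t) * (dsin 6 t) * (dsin 0 t)^5 + 264 * (dsin 2 t) *
      (dsin 6 t) * (dsin 0 t)^5 + 165 * (dsin 1 t)^3 * (dsin 7 t) * (dsin 0 t)^5 + 33 * (dsin 1
      t) * (dsin 7 t) * (dsin 0 t)^5 - 10338 * (dsin 2 t)^5 * (dsin 0 t)^4 - 95919 * (dsin 1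
      t)^2 * (dsin 2 t) * (dsin 3 t)^2 * (dsin 0 t)^4 - 3729 * (dsin 2 t) * (dsin 3 t)^2 *
      (dsin 0 t)^4 - 117600 * (dsin 1 t) * (dsin 2 t)^3 * (dsin 3 t) * (dsin 0 t)^4 - 68664 *
      (dsin 1 t)^2 * (dsin 2 t)^2 * (dsin 4 t) * (dsin 0 t)^4 - 2772 * (dsin 2 t)^2 * (dsin 4
      t) * (dsin 0 t)^4 - 23976 * (dsin 1 t)^3 * (dsin 3 t) * (dsin 4 t) * (dsin 0 t)^4 - 2640
      * (dsin 1 t) * (dsin 3 t) * (dsin 4 t) * (dsin 0 t)^4 - 12762 * (dsin 1 t)^3 * (dsin 2 t)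
      * (dsin 5 t) * (dsin 0 t)^4 - 1386 * (dsin 1 t) * (dsin 2 t) * (dsin 5 t) * (dsin 0 t)^4
      - 651 * (dsin 1 t)^4 * (dsin 6 t) * (dsin 0 t)^4 - 132 * (dsin 1 t)^2 * (dsin 6 t) *
      (dsin 0 t)^4 + 111378 * (dsin 1 t)^2 * (dsin 2 t)^4 * (dsin 0 t)^3 + 2354 * (dsin 2 t)^4
      * (dsin 0 t)^3 + 31344 * (dsin 1 t)^4 * (dsin 3 t)^2 * (dsin 0 t)^3 + 3729 * (dsin 1 t)^2
      * (dsin 3 t)^2 * (dsin 0 t)^3 + 236706 * (dsin 1 t)^3 * (dsin 2 t)^2 * (dsin 3 t) * (dsin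
      0 t)^3 + 13926 * (dsin 1 t) * (dsin 2 t)^2 * (dsin 3 t) * (dsin 0 t)^3 + 43320 * (dsin 1
      t)^4 * (dsin 2 t) * (dsin 4 t) * (dsin 0 t)^3 + 5214 * (dsin 1 t)^2 * (dsin 2 t) * (dsin
      4 t) * (dsin 0 t)^3 + 2238 * (dsin 1 t)^5 * (dsin 5 t) * (dsin 0 t)^3 + 462 * (dsin 1
      t)^3 * (dsin 5 t) * (dsin 0 t)^3 - 162162 * (dsin 1 t)^4 * (dsin 2 t)^3 * (dsin 0 t)^2 -
      11880 * (dsin 1 t)^2 * (dsin 2 t)^3 * (dsin 0 t)^2 - 103884 * (dsin 1 t)^5 * (dsin 2 t) *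
      (dsin 3 t) * (dsin 0 t)^2 - 13332 * (dsin 1 t)^3 * (dsin 2 t) * (dsin 3 t) * (dsin 0 t)^2
      - 6138 * (dsin 1 t)^6 * (dsin 4 t) * (dsin 0 t)^2 - 1287 * (dsin 1 t)^4 * (dsin 4 t) *
      (dsin 0 t)^2 + 76440 * (dsin 1 t)^6 * (dsin 2 t)^2 * (dsin 0 t) + 10428 * (dsin 1 t)^4 *
      (dsin 2 t)^2 * (dsin 0 t) + 11700 * (dsin 1 t)^7 * (dsin 3 t) * (dsin 0 t) + 2475 * (dsin
      1 t)^5 * (dsin 3 t) * (dsin 0 t) - 11700 * (dsin 1 t)^8 * (dsin 2 t) - 2475 * (dsin 1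
      t)^6 * (dsin 2 t))
      = (31 / 15840) * Real.sin t ^ 3 := by
  have hs : sin t ≠ 0 := (sin_pos_of_pos_of_lt_pi ht0 ht1).ne'
  simp only [dsin_zero, dsin_one, dsin_add_two, neg_neg]
  have hc : cos t ^ 2 = 1 - sin t ^ 2 := cos_sq' t
  rw [one_div, inv_mul_eq_iff_eq_mul₀ (by positivity)]
  grind
end

section
/- With H and h_n as defined, h_10 = 1/221760. -/
open Complex

/-- The recursively defined quantities `H n j α` from Chamseddine–Connes'
recursion for the coefficient of the highest order term in the heat
coefficients of the Robertson–Walker metric. -/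
noncomputable def rwH : ℕ → ℕ → ℕ → ℂ
  | 1, 2, 1 => 3 * Complex.I / (2 * (Real.sqrt Real.pi : ℂ))
  | 1, 3, 1 => 3 * Complex.I / (2 * (Real.sqrt Real.pi : ℂ))
  | 2, 2, 0 => 3 / (4 * (Real.sqrt Real.pi : ℂ))
  | 2, 3, 0 => 3 / (4 * (Real.sqrt Real.pi : ℂ))
  | 2, 3, 2 => -3 / (2 * (Real.sqrt Real.pi : ℂ))
  | 2, 4, 2 => -1 / (Real.sqrt Real.pi : ℂ)
  | n+3, j+2, α+1 =>
      (1 / ((j : ℂ) + 1)) * (rwH (n+1) (j+1) (α+1) + 2 * Complex.I * rwH (n+2) (j+1) α)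
  | n+3, j+2, 0 => (1 / ((j : ℂ) + 1)) * rwH (n+1) (j+1) 0
  | _, _, _ => 0

/-- The coefficient `h_n` of `a(t)^{n-1} a^{(n)}(t)` in the heat coefficient `a_n`. -/
noncomputable def rwh (n : ℕ) : ℂ :=
  ∑ j ∈ Finset.Icc (n / 2 + 1) (2 * n + 1), ∑ k ∈ Finset.range (j - n / 2),
    ((Real.Gamma ((k : ℝ) + 1 / 2) : ℂ)) * rwH n j (2 * k)

/-- The rational part of `rwH`: `rwH n j α = I ^ α * rwHRat n j α / √π`. -/
def rwHRat : ℕ → ℕ → ℕ → ℚ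
  | 1, 2, 1 => 3 / 2
  | 1, 3, 1 => 3 / 2
  | 2, 2, 0 => 3 / 4
  | 2, 3, 0 => 3 / 4
  | 2, 3, 2 => 3 / 2
  | 2, 4, 2 => 1
  | n+3, j+2, α+1 => (1 / ((j : ℚ) + 1)) * (rwHRat (n+1) (j+1) (α+1) + 2 * rwHRat (n+2) (j+1) α)
  | n+3, j+2, 0 => (1 / ((j : ℚ) + 1)) * rwHRat (n+1) (j+1) 0
  | _, _, _ => 0

theorem rwH_eq (n j α : ℕ) :
    rwH n j α = I ^ α * (rwHRat n j α : ℂ) / (Real.sqrt Real.pi : ℂ) := by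
  fun_induction rwHRat n j α with
  | case7 n j α ih₁ ih₂ =>
    rw [rwH, ih₁, ih₂, Nat.succ_eq_add_one, pow_succ]
    push_cast
    ring
  | case8 n j ih =>
    rw [rwH, ih]
    push_cast
    ring
  | case9 =>
    rw [rwH] <;> simp_all
  | _ =>
    rw [rwH]
    push_cast
    simp only [I_sq, pow_one, pow_zero]
    ring

/-- The rational part of `Γ(k + 1/2)`. -/
def gammaHalfRat : ℕ → ℚ
  | 0 => 1
  | k + 1 => ((k : ℚ) + 1 / 2) * gammaHalfRat k

theorem Gamma_nat_add_half_eq (k : ℕ) :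
    Real.Gamma ((k : ℝ) + 1 / 2) = (gammaHalfRat k : ℝ) * Real.sqrt Real.pi := by
  induction k with
  | zero => simp [gammaHalfRat, Real.Gamma_one_half_eq, -one_div]
  | succ k ih =>
    rw [show ((k + 1 : ℕ) : ℝ) + 1 / 2 = ((k : ℝ) + 1 / 2) + 1 by push_cast; ring,
      Real.Gamma_add_one (by positivity), ih, gammaHalfRat]
    push_cast
    ring

theorem rwh_eq_sum_rat (n : ℕ) :
    rwh n = ((∑ j ∈ Finset.Icc (n / 2 + 1) (2 * n + 1), ∑ k ∈ Finset.range (j - n / 2),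
      gammaHalfRat k * ((-1) ^ k * rwHRat n j (2 * k)) : ℚ) : ℂ) := by
  have hpi : (Real.sqrt Real.pi : ℂ) ≠ 0 := by
    exact_mod_cast (Real.sqrt_pos.mpr Real.pi_pos).ne'
  rw [rwh]
  push_cast
  refine Finset.sum_congr rfl fun j _ => Finset.sum_congr rfl fun k _ => ?_
  rw [rwH_eq, Gamma_nat_add_half_eq, pow_mul, I_sq]
  push_cast
  field_simp

theorem rwh_ten : rwh 10 = 1 / 221760 := by
  have h : ∑ j ∈ Finset.Icc (10 / 2 + 1) (2 * 10 + 1), ∑ k ∈ Finset.range (j - 10 / 2),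
      gammaHalfRat k * ((-1) ^ k * rwHRat 10 j (2 * k)) = 1 / 221760 := by
    decide +kernel
  rw [rwh_eq_sum_rat, h]
  norm_num
end
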